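/- Let F : P → ∇K be a cofiltration of a finite simplicial complex K indexed by a finite poset P, with compactly supported cochains over a field 𝔽. Let H^d_c F : P → Vect_𝔽 be its d-th compactly supported cohomology persistence module, H^d_c F(a) = Z^d F(a)/B^d F(a) with maps induced by the injective cochain maps, and let ker H^d_c F : Int P → ℤ be its kernel function, ker H^d_c F[a,b] = dim ker(H^d_c F(a) → H^d_c F(b)). Then the Möbius inversions ∂BD^d F and ∂(ker H^d_c F) agree away from the diagonal: ∂BD^d F[a,b] = ∂(ker H^d_c F)[a,b] for all a < b in P. -/

import Mathlib

set_option linter.unusedSectionVars false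
set_option linter.unusedVariables false

open Classical

/-- The poset `Int P` of intervals `[a, b]` of a poset `P` (encoded as pairs `a ≤ b`),
equipped with the product ordering `[a,b] ≤ [c,d] ↔ a ≤ c ∧ b ≤ d`. -/
abbrev Itv (P : Type*) [PartialOrder P] : Type _ := {p : P × P // p.1 ≤ p.2}

/-- `dm` is the Möbius inversion `∂m` of `m`: the unique function satisfying
`m y = ∑_{x ≤ y} dm x` for all `y` in the finite poset `R`. -/
def IsMobiusInv {R : Type*} [PartialOrder R] [Fintype R] (m dm : R → ℤ) : Prop :=
  ∀ y : R, m y = ∑ x : R, if x ≤ y then dm x else 0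

variable {V : Type*} [LinearOrder V]

/-- `K` is a finite abstract simplicial complex. -/
def IsComplex (K : Finset (Finset V)) : Prop :=
  (∀ s ∈ K, s.Nonempty) ∧ ∀ s ∈ K, ∀ t : Finset V, t ⊆ s → t.Nonempty → t ∈ K

/-- `A` is a subcomplex of `K`. -/
def IsSubcomplexOf (K A : Finset (Finset V)) : Prop :=
  A ⊆ K ∧ ∀ s ∈ A, ∀ t : Finset V, t ⊆ s → t.Nonempty → t ∈ A

/-- `A` is a supcomplex of `K` (closed under taking cofaces in `K`). -/
def IsSupcomplexOf (K A : Finset (Finset V)) : Prop :=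
  A ⊆ K ∧ ∀ s ∈ A, ∀ t ∈ K, s ⊆ t → t ∈ A

/-- The `d`-dimensional simplices of `A`. -/
def dsimp (A : Finset (Finset V)) (d : ℕ) : Finset (Finset V) :=
  A.filter fun s => s.card = d + 1

variable (𝔽 : Type*) [Field 𝔽]

/-- `d`-chains on `A` with coefficients in `𝔽`. -/
abbrev Chains (A : Finset (Finset V)) (d : ℕ) : Type _ := ↥(dsimp A d) → 𝔽

/-- The sign of vertex `v` in the simplex `τ`. -/
def sgn (τ : Finset V) (v : V) : 𝔽 := (-1) ^ (τ.filter fun w => w < v).card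

/-- Incidence coefficient of `σ` in the boundary of `τ`. -/
def co (τ σ : Finset V) : 𝔽 := ∑ v ∈ τ, if σ = τ.erase v then sgn 𝔽 τ v else 0

/-- Boundary operator relative to `A`: faces not in `A` are omitted. -/
noncomputable def bdry (A : Finset (Finset V)) (d : ℕ) :
    Chains 𝔽 A (d + 1) →ₗ[𝔽] Chains 𝔽 A d :=
  LinearMap.pi fun σ => ∑ τ : ↥(dsimp A (d + 1)), co 𝔽 τ.1 σ.1 • LinearMap.proj τ

/-- Coboundary operator relative to `A` (transpose of `bdry`). -/
noncomputable def cobdry (A : Finset (Finset V)) (d : ℕ) :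
    Chains 𝔽 A d →ₗ[𝔽] Chains 𝔽 A (d + 1) :=
  LinearMap.pi fun τ : ↥(dsimp A (d + 1)) =>
    ∑ v ∈ τ.1, sgn 𝔽 τ.1 v •
      (if h : τ.1.erase v ∈ dsimp A d then
        (LinearMap.proj ⟨τ.1.erase v, h⟩ : Chains 𝔽 A d →ₗ[𝔽] 𝔽) else 0)

/-- Extension by zero `C(A) → C(B)`; for subcomplex pairs it is the inclusion of chains,
and it is also the injective cochain map dual to the surjection of chains. -/
noncomputable def incl (A B : Finset (Finset V)) (d : ℕ) :
    Chains 𝔽 A d →ₗ[𝔽] Chains 𝔽 B d :=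
  LinearMap.pi fun σ : ↥(dsimp B d) =>
    if h : σ.1 ∈ dsimp A d then
      (LinearMap.proj ⟨σ.1, h⟩ : Chains 𝔽 A d →ₗ[𝔽] 𝔽) else 0

/-- Cycles. -/
noncomputable def cycles (A : Finset (Finset V)) : (d : ℕ) → Submodule 𝔽 (Chains 𝔽 A d)
  | 0 => ⊤
  | d + 1 => LinearMap.ker (bdry 𝔽 A d)

/-- Boundaries. -/
noncomputable def bounds (A : Finset (Finset V)) (d : ℕ) : Submodule 𝔽 (Chains 𝔽 A d) :=
  LinearMap.range (bdry 𝔽 A d)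

/-- Cocycles. -/
noncomputable def cocycles (A : Finset (Finset V)) (d : ℕ) : Submodule 𝔽 (Chains 𝔽 A d) :=
  LinearMap.ker (cobdry 𝔽 A d)

/-- Coboundaries. -/
noncomputable def cobounds (A : Finset (Finset V)) : (d : ℕ) → Submodule 𝔽 (Chains 𝔽 A d)
  | 0 => ⊥
  | d + 1 => LinearMap.range (cobdry 𝔽 A d)

/-- Birth-death function of a filtration: `BD_d F [a,b] = dim (Z_d F(a) ∩ B_d F(b))`. -/
noncomputable def BDh {P : Type*} [PartialOrder P] (F : P → Finset (Finset V)) (d : ℕ)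
    (I : Itv P) : ℤ :=
  Module.finrank 𝔽
    ↥((cycles 𝔽 (F I.1.1) d).map (incl 𝔽 (F I.1.1) (F I.1.2) d) ⊓ bounds 𝔽 (F I.1.2) d)

/-- Birth-death function of a cofiltration: `BD^d F [a,b] = dim (Z^d F(a) ∩ B^d F(b))`. -/
noncomputable def BDc {P : Type*} [PartialOrder P] (F : P → Finset (Finset V)) (d : ℕ)
    (I : Itv P) : ℤ :=
  Module.finrank 𝔽
    ↥((cocycles 𝔽 (F I.1.1) d).map (incl 𝔽 (F I.1.1) (F I.1.2) d) ⊓ cobounds 𝔽 (F I.1.2) d)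

lemma incl_apply (A B : Finset (Finset V)) (d : ℕ) (c : Chains 𝔽 A d) (σ : ↥(dsimp B d)) :
    incl 𝔽 A B d c σ = if h : σ.1 ∈ dsimp A d then c ⟨σ.1, h⟩ else 0 := by
  rw [incl, LinearMap.pi_apply]
  by_cases h : σ.1 ∈ dsimp A d
  · rw [dif_pos h, dif_pos h]; rfl
  · rw [dif_neg h, dif_neg h, LinearMap.zero_apply]

lemma bdry_apply (A : Finset (Finset V)) (d : ℕ) (c : Chains 𝔽 A (d+1)) (σ : ↥(dsimp A d)) :
    bdry 𝔽 A d c σ = ∑ τ : ↥(dsimp A (d+1)), co 𝔽 τ.1 σ.1 * c τ := by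
  simp [bdry, LinearMap.pi_apply, LinearMap.sum_apply, LinearMap.smul_apply, smul_eq_mul]

lemma cobdry_apply (A : Finset (Finset V)) (d : ℕ) (c : Chains 𝔽 A d) (τ : ↥(dsimp A (d+1))) :
    cobdry 𝔽 A d c τ
      = ∑ v ∈ τ.1, sgn 𝔽 τ.1 v * (if h : τ.1.erase v ∈ dsimp A d then c ⟨τ.1.erase v, h⟩ else 0) := by
  rw [cobdry, LinearMap.pi_apply, LinearMap.sum_apply]
  refine Finset.sum_congr rfl fun v hv => ?_
  rw [LinearMap.smul_apply, smul_eq_mul]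
  by_cases h : τ.1.erase v ∈ dsimp A d
  · rw [dif_pos h, dif_pos h]; rfl
  · rw [dif_neg h, dif_neg h, LinearMap.zero_apply]

lemma mem_dsimp {A : Finset (Finset V)} {t : Finset V} {d : ℕ} :
    t ∈ dsimp A d ↔ t ∈ A ∧ t.card = d + 1 := Finset.mem_filter

lemma incl_bdry_comm (A B : Finset (Finset V)) (hAB : A ⊆ B)
    (hA : ∀ s ∈ A, ∀ t : Finset V, t ⊆ s → t.Nonempty → t ∈ A) (d : ℕ) :
    (bdry 𝔽 B d).comp (incl 𝔽 A B (d + 1)) = (incl 𝔽 A B d).comp (bdry 𝔽 A d) := by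
  have hsub : dsimp A (d+1) ⊆ dsimp B (d+1) := fun t ht =>
    mem_dsimp.2 ⟨hAB (mem_dsimp.1 ht).1, (mem_dsimp.1 ht).2⟩
  refine LinearMap.ext fun c => funext fun σ => ?_
  rw [LinearMap.comp_apply, LinearMap.comp_apply, bdry_apply, incl_apply]
  simp only [incl_apply]
  by_cases hσ : σ.1 ∈ dsimp A d
  · rw [dif_pos hσ, bdry_apply]
    have e0 : ∀ τ : ↥(dsimp B (d+1)),
        co 𝔽 τ.1 σ.1 * (if h : τ.1 ∈ dsimp A (d + 1) then c ⟨τ.1, h⟩ else 0)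
          = (fun t => if h : t ∈ dsimp A (d + 1) then co 𝔽 t σ.1 * c ⟨t, h⟩ else 0) τ.1 := by
      intro τ; by_cases h : τ.1 ∈ dsimp A (d+1) <;> simp [h]
    rw [Finset.sum_congr rfl (fun τ _ => e0 τ),
      Finset.sum_coe_sort (dsimp B (d+1))
        (fun t => if h : t ∈ dsimp A (d + 1) then co 𝔽 t σ.1 * c ⟨t, h⟩ else 0),
      ← Finset.sum_subset hsub (fun t _ ht => dif_neg ht),
      ← Finset.sum_coe_sort (dsimp A (d+1))
        (fun t => if h : t ∈ dsimp A (d + 1) then co 𝔽 t σ.1 * c ⟨t, h⟩ else 0)]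
    exact Finset.sum_congr rfl fun τ _ => by rw [dif_pos τ.2]
  · rw [dif_neg hσ]
    refine Finset.sum_eq_zero fun τ _ => ?_
    by_cases h : τ.1 ∈ dsimp A (d+1)
    · rw [dif_pos h]
      have hco : co 𝔽 τ.1 σ.1 = 0 := by
        refine Finset.sum_eq_zero fun v hv => ?_
        rw [if_neg]
        intro he
        refine hσ (mem_dsimp.2 ⟨?_, (mem_dsimp.1 σ.2).2⟩)
        refine hA τ.1 (mem_dsimp.1 h).1 σ.1 ?_ ?_
        · rw [he]; exact Finset.erase_subset _ _
        · refine Finset.card_pos.1 ?_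
          rw [(mem_dsimp.1 σ.2).2]; omega
      rw [hco, zero_mul]
    · rw [dif_neg h, mul_zero]

lemma cyclesLe {A B : Finset (Finset V)} (hAB : A ⊆ B)
    (hA : ∀ s ∈ A, ∀ t : Finset V, t ⊆ s → t.Nonempty → t ∈ A) (d : ℕ) :
    cycles 𝔽 A d ≤ (cycles 𝔽 B d).comap (incl 𝔽 A B d) := by
  cases d with
  | zero => simp [cycles]
  | succ d =>
    intro c hc
    have hcomm := LinearMap.congr_fun (incl_bdry_comm 𝔽 A B hAB hA d) c
    simp only [LinearMap.comp_apply] at hcomm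
    simp only [cycles, Submodule.mem_comap, LinearMap.mem_ker] at hc ⊢
    rw [hcomm, hc, map_zero]

lemma boundsLe {A B : Finset (Finset V)} (hAB : A ⊆ B)
    (hA : ∀ s ∈ A, ∀ t : Finset V, t ⊆ s → t.Nonempty → t ∈ A) (d : ℕ) :
    bounds 𝔽 A d ≤ (bounds 𝔽 B d).comap (incl 𝔽 A B d) := by
  rintro c ⟨x, rfl⟩
  have hcomm := LinearMap.congr_fun (incl_bdry_comm 𝔽 A B hAB hA d) x
  simp only [LinearMap.comp_apply] at hcomm
  exact Submodule.mem_comap.2 ⟨incl 𝔽 A B (d+1) x, hcomm⟩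

lemma incl_cobdry_comm (A B : Finset (Finset V)) (hAB : A ⊆ B)
    (hA : ∀ s ∈ A, ∀ t ∈ B, s ⊆ t → t ∈ A) (d : ℕ) :
    (cobdry 𝔽 B d).comp (incl 𝔽 A B d) = (incl 𝔽 A B (d + 1)).comp (cobdry 𝔽 A d) := by
  have hsubd : dsimp A d ⊆ dsimp B d := fun t ht =>
    mem_dsimp.2 ⟨hAB (mem_dsimp.1 ht).1, (mem_dsimp.1 ht).2⟩
  refine LinearMap.ext fun c => funext fun τ => ?_
  rw [LinearMap.comp_apply, LinearMap.comp_apply, cobdry_apply, incl_apply]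
  by_cases hτ : τ.1 ∈ dsimp A (d+1)
  · rw [dif_pos hτ, cobdry_apply]
    refine Finset.sum_congr rfl fun v hv => ?_
    by_cases h' : τ.1.erase v ∈ dsimp A d
    · simp [incl_apply, hsubd h', h']
    · have h'' : ∀ hb : τ.1.erase v ∈ dsimp B d,
          incl 𝔽 A B d c ⟨τ.1.erase v, hb⟩ = 0 := fun hb => by
        rw [incl_apply, dif_neg h']
      by_cases h : τ.1.erase v ∈ dsimp B d
      · rw [dif_pos h, h'' h, dif_neg h']
      · rw [dif_neg h, dif_neg h']
  · rw [dif_neg hτ]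
    refine Finset.sum_eq_zero fun v hv => ?_
    by_cases h : τ.1.erase v ∈ dsimp B d
    · rw [dif_pos h, incl_apply, dif_neg, mul_zero]
      intro h'
      exact hτ (mem_dsimp.2 ⟨hA _ (mem_dsimp.1 h').1 τ.1 (mem_dsimp.1 τ.2).1
        (Finset.erase_subset _ _), (mem_dsimp.1 τ.2).2⟩)
    · rw [dif_neg h, mul_zero]

lemma cocyclesLe {A B : Finset (Finset V)} (hAB : A ⊆ B)
    (hA : ∀ s ∈ A, ∀ t ∈ B, s ⊆ t → t ∈ A) (d : ℕ) :
    cocycles 𝔽 A d ≤ (cocycles 𝔽 B d).comap (incl 𝔽 A B d) := by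
  intro c hc
  have hcomm := LinearMap.congr_fun (incl_cobdry_comm 𝔽 A B hAB hA d) c
  simp only [LinearMap.comp_apply] at hcomm
  simp only [cocycles, Submodule.mem_comap, LinearMap.mem_ker] at hc ⊢
  rw [hcomm, hc, map_zero]

lemma coboundsLe {A B : Finset (Finset V)} (hAB : A ⊆ B)
    (hA : ∀ s ∈ A, ∀ t ∈ B, s ⊆ t → t ∈ A) (d : ℕ) :
    cobounds 𝔽 A d ≤ (cobounds 𝔽 B d).comap (incl 𝔽 A B d) := by
  cases d with
  | zero => simp [cobounds]
  | succ d =>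
    rintro c ⟨x, rfl⟩
    have hcomm := LinearMap.congr_fun (incl_cobdry_comm 𝔽 A B hAB hA d) x
    simp only [LinearMap.comp_apply] at hcomm
    exact Submodule.mem_comap.2 ⟨incl 𝔽 A B d x, hcomm⟩

/-- Compactly supported simplicial cohomology of `A` in degree `d`:
`H^d_c(A) = Z^d(A)/B^d(A)`. -/
abbrev cohomologyM (A : Finset (Finset V)) (d : ℕ) :=
  ↥(cocycles 𝔽 A d) ⧸ ((cobounds 𝔽 A d).comap (cocycles 𝔽 A d).subtype)

/-- The map `H^d_c(A) → H^d_c(B)` induced on cohomology by the injective cochain map. -/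
noncomputable def inducedHc {A B : Finset (Finset V)} {d : ℕ}
    (hZ : cocycles 𝔽 A d ≤ (cocycles 𝔽 B d).comap (incl 𝔽 A B d))
    (hB : cobounds 𝔽 A d ≤ (cobounds 𝔽 B d).comap (incl 𝔽 A B d)) :
    cohomologyM 𝔽 A d →ₗ[𝔽] cohomologyM 𝔽 B d :=
  Submodule.mapQ _ _ ((incl 𝔽 A B d).restrict (fun c hc => hZ hc))
    (fun z hz => hB hz)


lemma incl_injective_aux {A B : Finset (Finset V)} (hAB : A ⊆ B) (d : ℕ) :
    Function.Injective (incl 𝔽 A B d) := by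
  intro x y hxy
  funext σ
  have hB : σ.1 ∈ dsimp B d := mem_dsimp.2 ⟨hAB (mem_dsimp.1 σ.2).1, (mem_dsimp.1 σ.2).2⟩
  have h := congrFun hxy ⟨σ.1, hB⟩
  rw [incl_apply, incl_apply, dif_pos σ.2, dif_pos σ.2] at h
  exact h

lemma finrank_ker_mapQ_aux {M N : Type*} [AddCommGroup M] [AddCommGroup N] [Module 𝔽 M]
    [Module 𝔽 N] [FiniteDimensional 𝔽 M] (p : Submodule 𝔽 M) (q : Submodule 𝔽 N)
    (f : M →ₗ[𝔽] N) (h : p ≤ q.comap f) :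
    Module.finrank 𝔽 ↥(LinearMap.ker (Submodule.mapQ p q f h)) + Module.finrank 𝔽 p
      = Module.finrank 𝔽 ↥(q.comap f) := by
  have hr : LinearMap.range (p.mkQ.comp (q.comap f).subtype)
      = LinearMap.ker (Submodule.mapQ p q f h) := by
    ext x
    obtain ⟨m, rfl⟩ := p.mkQ_surjective x
    simp only [LinearMap.mem_range, LinearMap.mem_ker, LinearMap.comp_apply, Submodule.mkQ_apply,
      Submodule.mapQ_apply, Submodule.Quotient.mk_eq_zero]
    constructor
    · rintro ⟨y, hy⟩
      have h1 := h ((Submodule.Quotient.eq p).1 hy)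
      have h2 := (q.comap f).sub_mem y.2 h1
      simpa using h2
    · intro hm
      exact ⟨⟨m, hm⟩, rfl⟩
  have hk : LinearMap.ker (p.mkQ.comp (q.comap f).subtype) = p.comap (q.comap f).subtype := by
    rw [LinearMap.ker_comp, Submodule.ker_mkQ]
  have := LinearMap.finrank_range_add_finrank_ker (p.mkQ.comp (q.comap f).subtype)
  rw [hr, hk, (Submodule.comapSubtypeEquivOfLe h).finrank_eq] at this
  exact this

lemma finrank_BD_aux {A B : Finset (Finset V)} (hAB : A ⊆ B) (d : ℕ)
    (hZ : cocycles 𝔽 A d ≤ (cocycles 𝔽 B d).comap (incl 𝔽 A B d))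
    (hB : cobounds 𝔽 A d ≤ (cobounds 𝔽 B d).comap (incl 𝔽 A B d)) :
    Module.finrank 𝔽 ↥((cocycles 𝔽 A d).map (incl 𝔽 A B d) ⊓ cobounds 𝔽 B d)
      = Module.finrank 𝔽 ↥(LinearMap.ker (inducedHc 𝔽 hZ hB))
        + Module.finrank 𝔽 ↥((cobounds 𝔽 A d).comap (cocycles 𝔽 A d).subtype) := by
  refine Eq.trans ?_ (finrank_ker_mapQ_aux 𝔽
    ((cobounds 𝔽 A d).comap (cocycles 𝔽 A d).subtype)
    ((cobounds 𝔽 B d).comap (cocycles 𝔽 B d).subtype)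
    ((incl 𝔽 A B d).restrict (fun c hc => hZ hc)) (fun z hz => hB hz)).symm
  have hinj : Function.Injective ((incl 𝔽 A B d).comp (cocycles 𝔽 A d).subtype) :=
    (incl_injective_aux 𝔽 hAB d).comp Subtype.val_injective
  have e : (cocycles 𝔽 A d).map (incl 𝔽 A B d) ⊓ cobounds 𝔽 B d
      = (((cobounds 𝔽 B d).comap (cocycles 𝔽 B d).subtype).comap
          ((incl 𝔽 A B d).restrict (fun c hc => hZ hc))).map
        ((incl 𝔽 A B d).comp (cocycles 𝔽 A d).subtype) := by
    ext x
    constructor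
    · rintro ⟨⟨c, hc, rfl⟩, hx⟩
      exact ⟨⟨c, hc⟩, hx, rfl⟩
    · rintro ⟨c, hc, rfl⟩
      exact ⟨⟨c.1, c.2, rfl⟩, hc⟩
  rw [e]
  exact (Submodule.equivMapOfInjective _ hinj _).finrank_eq.symm

lemma mobius_aux {P : Type*} [PartialOrder P] [Fintype P] (m n dm dn : Itv P → ℤ) (f : P → ℤ)
    (h1 : IsMobiusInv m dm) (h2 : IsMobiusInv n dn) (h : ∀ I, m I = n I + f I.1.1) :
    ∀ I : Itv P, I.1.1 < I.1.2 → dm I = dn I := by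
  have key : ∀ I : Itv P, (∑ x : Itv P, if x ≤ I then dm x - dn x else 0) = f I.1.1 := by
    intro I
    have e := h I
    rw [h1 I, h2 I] at e
    rw [← sub_eq_iff_eq_add', ← Finset.sum_sub_distrib] at e
    rw [← e]
    refine Finset.sum_congr rfl fun x _ => ?_
    split_ifs <;> simp
  intro I
  induction I using WellFoundedLT.induction with
  | ind I ih =>
    intro hI
    have e := (key I).trans (key ⟨(I.1.1, I.1.1), le_rfl⟩).symm
    rw [← sub_eq_zero, ← Finset.sum_sub_distrib, Finset.sum_eq_single I] at e
    · have hn : ¬ I ≤ ⟨(I.1.1, I.1.1), le_rfl⟩ := fun hle => absurd hI (not_lt_of_ge hle.2)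
      rw [if_pos le_rfl, if_neg hn] at e
      linarith
    · intro x _ hx
      by_cases hxI : x ≤ I
      · by_cases hx2 : x ≤ ⟨(I.1.1, I.1.1), le_rfl⟩
        · rw [if_pos hxI, if_pos hx2, sub_self]
        · have hlt : x.1.1 < x.1.2 := by
            refine lt_of_le_of_ne x.2 fun heq => hx2 ⟨hxI.1, ?_⟩
            exact heq ▸ hxI.1
          rw [if_pos hxI, if_neg hx2, ih x (lt_of_le_of_ne hxI hx) hlt]
          simp
      · have hx2 : ¬ x ≤ ⟨(I.1.1, I.1.1), le_rfl⟩ := fun hle => hxI ⟨hle.1, hle.2.trans I.2⟩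
        rw [if_neg hxI, if_neg hx2, sub_self]
    · simp


/-- The Möbius inversions of the birth-death function `BD^d F` and of the kernel
function `ker H^d_c F` of a cofiltration agree away from the diagonal. -/
theorem bd_equiv_ker_cohomology {P : Type*} [PartialOrder P] [Fintype P]
    (K : Finset (Finset V)) (hK : IsComplex K)
    (F : P → Finset (Finset V)) (hFmono : Monotone F)
    (hFsup : ∀ a, IsSupcomplexOf K (F a))
    (d : ℕ) (dBD dker : Itv P → ℤ)
    (h1 : IsMobiusInv (BDc 𝔽 F d) dBD)
    (h2 : IsMobiusInv (fun I : Itv P =>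
      (Module.finrank 𝔽 ↥(LinearMap.ker (inducedHc 𝔽
        (cocyclesLe 𝔽 (hFmono I.2)
          (fun s hs t ht hst => (hFsup I.1.1).2 s hs t ((hFsup I.1.2).1 ht) hst) d)
        (coboundsLe 𝔽 (hFmono I.2)
          (fun s hs t ht hst => (hFsup I.1.1).2 s hs t ((hFsup I.1.2).1 ht) hst) d))) : ℤ))
      dker) :
    ∀ I : Itv P, I.1.1 < I.1.2 → dBD I = dker I := by
  refine mobius_aux _ _ dBD dker
    (fun a => (Module.finrank 𝔽
      ↥((cobounds 𝔽 (F a) d).comap (cocycles 𝔽 (F a) d).subtype) : ℤ)) h1 h2 fun I => ?_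
  have := finrank_BD_aux 𝔽 (hFmono I.2) d
    (cocyclesLe 𝔽 (hFmono I.2)
      (fun s hs t ht hst => (hFsup I.1.1).2 s hs t ((hFsup I.1.2).1 ht) hst) d)
    (coboundsLe 𝔽 (hFmono I.2)
      (fun s hs t ht hst => (hFsup I.1.1).2 s hs t ((hFsup I.1.2).1 ht) hst) d)
  rw [BDc, this]
  push_cast
  rfl
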